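/- arXiv:2401.01628 — 2 statements merged into one kernel-verified Lean document; each statement's English description precedes it below -/
import Mathlib

section
/- Let d ≥ 3 and let ρ be a bounded probability density on ℝ^d with K-function f_μ. Then for every s ∈ ℝ^d, the Laplacian of f_μ at s exists and equals Δ f_μ(s) = (d−1) ∫_{ℝ^d} ‖s−x‖₂^{−1} ρ(x) dx. -/
open MeasureTheory

/-- The Laplacian of `f : ℝ^d → ℝ` exists at `s` with value `L` : `f` is differentiable
at `s`, each second partial derivative (along the standard coordinate directions) exists
at `s`, and their sum equals `L`. -/
def HasLaplacianAt {d : ℕ} (f : EuclideanSpace ℝ (Fin d) → ℝ) (L : ℝ)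
    (s : EuclideanSpace ℝ (Fin d)) : Prop :=
  DifferentiableAt ℝ f s ∧
  (∀ i : Fin d,
    DifferentiableAt ℝ (fun y => fderiv ℝ f y (EuclideanSpace.single i (1 : ℝ))) s) ∧
  ∑ i : Fin d,
    fderiv ℝ (fun y => fderiv ℝ f y (EuclideanSpace.single i (1 : ℝ))) s
      (EuclideanSpace.single i (1 : ℝ)) = L

open NormedSpace Module

section Normalize

variable {E : Type*} [NormedAddCommGroup E]

lemma NormedSpace.norm_normalize_le_one [NormedSpace ℝ E] (x : E) : ‖normalize x‖ ≤ 1 := by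
  by_cases hx : x = 0
  · simp [hx]
  · exact (norm_normalize hx).le

/-- The map `normalize` is Lipschitz at `z` with constant `2 / ‖z‖`. -/
lemma NormedSpace.norm_normalize_sub_normalize_le [NormedSpace ℝ E] {z : E} (hz : z ≠ 0) (w : E) :
    ‖normalize w - normalize z‖ ≤ 2 / ‖z‖ * ‖w - z‖ := by
  have hz' : 0 < ‖z‖ := norm_pos_iff.mpr hz
  have key : ‖z‖ • (normalize w - normalize z) = (‖z‖ - ‖w‖) • normalize w + (w - z) := by
    rw [smul_sub, sub_smul, norm_smul_normalize, norm_smul_normalize]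
    abel
  have h : ‖z‖ * ‖normalize w - normalize z‖ ≤ 2 * ‖w - z‖ := by
    calc ‖z‖ * ‖normalize w - normalize z‖ = ‖‖z‖ • (normalize w - normalize z)‖ := by
          rw [norm_smul, norm_norm]
      _ ≤ ‖(‖z‖ - ‖w‖) • normalize w‖ + ‖w - z‖ := by
          rw [key]
          exact norm_add_le _ _
      _ ≤ ‖w - z‖ * 1 + ‖w - z‖ := by
          rw [norm_smul]
          gcongr
          · rw [norm_sub_rev w z]
            exact abs_norm_sub_norm_le z w
          · exact norm_normalize_le_one w
      _ = 2 * ‖w - z‖ := by ring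
  rw [div_mul_eq_mul_div, le_div_iff₀ hz']
  linarith

variable [InnerProductSpace ℝ E]

lemma hasFDerivAt_norm_of_ne_zero {z : E} (hz : z ≠ 0) :
    HasFDerivAt (fun y : E => ‖y‖) (innerSL ℝ (normalize z)) z := by
  have hz' : ‖z‖ ≠ 0 := norm_ne_zero_iff.mpr hz
  have h := (hasStrictFDerivAt_norm_sq z).hasFDerivAt.sqrt (pow_ne_zero 2 hz')
  simp only [Real.sqrt_sq (norm_nonneg _)] at h
  convert h using 1
  ext v
  simp [NormedSpace.normalize]
  field_simp

/-- The derivative of `z ↦ ⟪v, normalize z⟫` at `z ≠ 0`. -/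
noncomputable def fderivInnerNormalize (v z : E) : E →L[ℝ] ℝ :=
  ‖z‖⁻¹ • innerSL ℝ v - (‖z‖⁻¹ ^ 3 * inner ℝ v z) • innerSL ℝ z

lemma hasFDerivAt_inner_normalize (v : E) {z : E} (hz : z ≠ 0) :
    HasFDerivAt (fun y : E => inner ℝ v (normalize y)) (fderivInnerNormalize v z) z := by
  have hz' : ‖z‖ ≠ 0 := norm_ne_zero_iff.mpr hz
  have h := ((hasDerivAt_inv hz').comp_hasFDerivAt z (hasFDerivAt_norm_of_ne_zero hz)).mul
    (innerSL ℝ v).hasFDerivAt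
  convert! h using 1
  · ext y
    simp [NormedSpace.normalize, real_inner_smul_right]
  · ext w
    simp [NormedSpace.normalize, fderivInnerNormalize]
    field_simp
    ring

lemma sum_fderivInnerNormalize_apply {ι : Type*} [Fintype ι] (b : OrthonormalBasis ι ℝ E) (z : E) :
    ∑ i, fderivInnerNormalize (b i) z (b i) = ((Fintype.card ι : ℝ) - 1) * ‖z‖⁻¹ := by
  by_cases hz : z = 0
  · simp [hz, fderivInnerNormalize]
  have hz' : ‖z‖ ≠ 0 := norm_ne_zero_iff.mpr hz
  have hsum : ∑ i, inner ℝ (b i) z * inner ℝ z (b i) = ‖z‖ ^ 2 := by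
    rw [← real_inner_self_eq_norm_sq, ← b.sum_inner_mul_inner z z]
    exact Finset.sum_congr rfl fun i _ => mul_comm _ _
  simp only [fderivInnerNormalize, sub_apply, smul_apply,
    innerSL_apply_apply, smul_eq_mul, mul_assoc, Finset.sum_sub_distrib, ← Finset.mul_sum, hsum]
  simp only [real_inner_self_eq_norm_sq, b.norm_eq_one]
  simp
  field_simp

end Normalize

section Integral

variable {E : Type*} [NormedAddCommGroup E] [MeasurableSpace E] [BorelSpace E]

lemma integrableOn_ball_inv_norm [NormedSpace ℝ E] [FiniteDimensional ℝ E] (μ : Measure E)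
    [μ.IsAddHaarMeasure] (hd : 2 ≤ finrank ℝ E) (r : ℝ) :
    IntegrableOn (fun x : E => ‖x‖⁻¹) (Metric.ball 0 r) μ := by
  have : Nontrivial E := nontrivial_of_finrank_pos (R := ℝ) (by omega)
  rw [integrableOn_fun_norm_addHaar μ (f := fun y : ℝ => y⁻¹)]
  have h : IntegrableOn (fun y : ℝ => y ^ (finrank ℝ E - 2)) (Set.Ioo 0 r) :=
    (continuous_pow _).integrableOn_Icc.mono_set Set.Ioo_subset_Icc_self
  refine h.congr_fun (fun y hy => ?_) measurableSet_Ioo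
  have hy' : y ≠ 0 := hy.1.ne'
  simp only [smul_eq_mul]
  rw [show finrank ℝ E - 1 = finrank ℝ E - 2 + 1 by omega, pow_succ, mul_assoc,
    mul_inv_cancel₀ hy', mul_one]

variable {ρ : E → ℝ} {C : ℝ} {μ : Measure E}

lemma integrable_div_norm_sub [NormedSpace ℝ E] [FiniteDimensional ℝ E]
    [μ.IsAddHaarMeasure] (hd : 2 ≤ finrank ℝ E) (hρ : Integrable ρ μ)
    (hρ_nonneg : ∀ x, 0 ≤ ρ x) (hρ_bdd : ∀ᵐ x ∂μ, ρ x ≤ C) (s : E) :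
    Integrable (fun x => ρ x / ‖s - x‖) μ := by
  have hball : Integrable ((Metric.ball (0 : E) 1).indicator fun x : E => ‖x‖⁻¹) μ :=
    (integrableOn_ball_inv_norm μ hd 1).integrable_indicator measurableSet_ball
  refine (((hball.comp_sub_left s).const_mul C).add hρ).mono'
    (hρ.aestronglyMeasurable.div₀ (by fun_prop)) ?_
  filter_upwards [hρ_bdd] with x hx
  have h0 := hρ_nonneg x
  rw [Real.norm_of_nonneg (by positivity)]
  by_cases hxs : s - x ∈ Metric.ball (0 : E) 1
  · simp only [Pi.add_apply, Set.indicator_of_mem hxs, div_eq_mul_inv]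
    have : ρ x * ‖s - x‖⁻¹ ≤ C * ‖s - x‖⁻¹ := by gcongr
    linarith
  · simp only [Pi.add_apply, Set.indicator_of_notMem hxs, mul_zero, zero_add]
    refine div_le_self h0 ?_
    simpa using hxs

variable [InnerProductSpace ℝ E]

lemma hasFDerivAt_integral_norm_sub_mul [SecondCountableTopology E] [NullSingletonClass μ]
    (hρ : Integrable ρ μ) (s : E) :
    Integrable (fun x => ρ x • innerSL ℝ (normalize (s - x))) μ ∧
    HasFDerivAt (fun t => ∫ x, (‖t - x‖ - ‖x‖) * ρ x ∂μ)
      (∫ x, ρ x • innerSL ℝ (normalize (s - x)) ∂μ) s := by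
  have hF_meas (t : E) : AEStronglyMeasurable (fun x => (‖t - x‖ - ‖x‖) * ρ x) μ :=
    AEStronglyMeasurable.mul (by fun_prop) hρ.aestronglyMeasurable
  refine hasFDerivAt_integral_of_dominated_loc_of_lip' (bound := fun x => |ρ x|) Filter.univ_mem
    (fun t _ => hF_meas t) ?_ ?_ ?_ hρ.abs ?_
  · refine (hρ.norm.const_mul ‖s‖).mono' (hF_meas s) (.of_forall fun x => ?_)
    rw [norm_mul]
    gcongr
    simpa [norm_sub_rev s x] using abs_norm_sub_norm_le (x - s) x
  · refine hρ.aestronglyMeasurable.smul ?_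
    refine (innerSL ℝ).continuous.comp_aestronglyMeasurable ?_
    have : Measurable fun x => normalize (s - x) := by
      unfold NormedSpace.normalize
      fun_prop
    exact this.aestronglyMeasurable
  · refine .of_forall fun x t _ => ?_
    rw [← sub_mul, norm_mul, mul_comm, Real.norm_eq_abs (ρ x)]
    gcongr
    simpa using abs_norm_sub_norm_le (t - x) (s - x)
  · filter_upwards [Measure.ae_ne μ s] with x hx
    have h := ((hasFDerivAt_norm_of_ne_zero (sub_ne_zero.mpr hx.symm)).comp s
      ((hasFDerivAt_id s).sub_const x)).sub_const ‖x‖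
    convert! h.mul_const (ρ x) using 1

lemma hasFDerivAt_integral_mul_inner_normalize_sub [SecondCountableTopology E] [NullSingletonClass μ]
    (hρ : Integrable ρ μ) (hρ_nonneg : ∀ x, 0 ≤ ρ x) (v s : E)
    (hs : Integrable (fun x => ρ x / ‖s - x‖) μ) :
    Integrable (fun x => ρ x • fderivInnerNormalize v (s - x)) μ ∧
    HasFDerivAt (fun t => ∫ x, ρ x * inner ℝ v (normalize (t - x)) ∂μ)
      (∫ x, ρ x • fderivInnerNormalize v (s - x) ∂μ) s := by
  have hF_meas (t : E) :
      AEStronglyMeasurable (fun x => ρ x * inner ℝ v (normalize (t - x))) μ := by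
    refine hρ.aestronglyMeasurable.mul ?_
    have : Measurable fun x => inner ℝ v (normalize (t - x)) := by
      unfold NormedSpace.normalize
      fun_prop
    exact this.aestronglyMeasurable
  refine hasFDerivAt_integral_of_dominated_loc_of_lip'
    (bound := fun x => 2 * ‖v‖ * (ρ x / ‖s - x‖)) Filter.univ_mem
    (fun t _ => hF_meas t) ?_ ?_ ?_ (hs.const_mul _) ?_
  · refine (hρ.norm.mul_const ‖v‖).mono' (hF_meas s) (.of_forall fun x => ?_)
    rw [norm_mul]
    gcongr
    exact (norm_inner_le_norm _ _).trans
      (mul_le_of_le_one_right (norm_nonneg _) (norm_normalize_le_one _))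
  · refine hρ.aestronglyMeasurable.smul ?_
    have h₁ : AEStronglyMeasurable (fun x => innerSL ℝ (s - x)) μ :=
      (innerSL ℝ).continuous.comp_aestronglyMeasurable (by fun_prop)
    have h₂ : Measurable fun x => ‖s - x‖⁻¹ := by fun_prop
    have h₃ : Measurable fun x => ‖s - x‖⁻¹ ^ 3 * inner ℝ v (s - x) := by fun_prop
    exact (h₂.aestronglyMeasurable.smul aestronglyMeasurable_const).sub
      (h₃.aestronglyMeasurable.smul h₁)
  · filter_upwards [Measure.ae_ne μ s] with x hx t _
    have h0 := hρ_nonneg x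
    have hlip := norm_normalize_sub_normalize_le (sub_ne_zero.mpr hx.symm) (t - x)
    rw [sub_sub_sub_cancel_right] at hlip
    rw [← mul_sub, ← inner_sub_right, norm_mul, Real.norm_of_nonneg h0]
    calc ρ x * ‖inner ℝ v (normalize (t - x) - normalize (s - x))‖
        ≤ ρ x * (‖v‖ * (2 / ‖s - x‖ * ‖t - s‖)) := by
          gcongr
          exact (norm_inner_le_norm _ _).trans (by gcongr)
      _ = 2 * ‖v‖ * (ρ x / ‖s - x‖) * ‖t - s‖ := by ring
  · filter_upwards [Measure.ae_ne μ s] with x hx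
    have h := (hasFDerivAt_inner_normalize v (sub_ne_zero.mpr hx.symm)).comp s
      ((hasFDerivAt_id s).sub_const x)
    convert! h.const_mul (ρ x) using 1

end Integral

/-- For `d ≥ 3` and a bounded probability density `ρ` on `ℝ^d`, the Laplacian of the
K-function `f_μ(s) = ∫ (‖s-x‖₂ - ‖x‖₂) ρ(x) dx` exists at every `s` and equals
`(d-1) ∫ ‖s-x‖₂⁻¹ ρ(x) dx`. -/
theorem laplacian_K_function
    (d : ℕ) (hd : 3 ≤ d)
    (ρ : EuclideanSpace ℝ (Fin d) → ℝ)
    (hρ_meas : Measurable ρ)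
    (hρ_nonneg : ∀ x, 0 ≤ ρ x)
    (C : ℝ) (hρ_bdd : ∀ᵐ x ∂volume, ρ x ≤ C)
    (hρ_int : ∫ x, ρ x ∂volume = 1)
    (s : EuclideanSpace ℝ (Fin d)) :
    HasLaplacianAt (fun t => ∫ x, (‖t - x‖ - ‖x‖) * ρ x ∂volume)
      (((d : ℝ) - 1) * ∫ x, ρ x / ‖s - x‖ ∂volume) s := by
  have hd' : 2 ≤ finrank ℝ (EuclideanSpace ℝ (Fin d)) := by
    rw [finrank_euclideanSpace_fin]
    omega
  have : Nontrivial (EuclideanSpace ℝ (Fin d)) := nontrivial_of_finrank_pos (R := ℝ) (by omega)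
  have hρ : Integrable ρ := by
    by_contra h
    simp [integral_undef h] at hρ_int
  have hs := integrable_div_norm_sub hd' hρ hρ_nonneg hρ_bdd s
  have hfderiv (v : EuclideanSpace ℝ (Fin d)) :
      (fun y => fderiv ℝ (fun t => ∫ x, (‖t - x‖ - ‖x‖) * ρ x) y v) =
        fun y => ∫ x, ρ x * inner ℝ v (normalize (y - x)) := by
    funext y
    obtain ⟨hint, hder⟩ := hasFDerivAt_integral_norm_sub_mul hρ y
    rw [hder.fderiv, ContinuousLinearMap.integral_apply hint]
    simp [real_inner_comm]
  have hsecond (v : EuclideanSpace ℝ (Fin d)) :=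
    hasFDerivAt_integral_mul_inner_normalize_sub hρ hρ_nonneg v s hs
  refine ⟨(hasFDerivAt_integral_norm_sub_mul hρ s).2.differentiableAt, fun i => ?_, ?_⟩
  · rw [hfderiv]
    exact (hsecond _).2.differentiableAt
  · simp only [hfderiv, (hsecond _).2.fderiv, ContinuousLinearMap.integral_apply (hsecond _).1]
    rw [← integral_finsetSum _ fun i _ => (hsecond _).1.apply_continuousLinearMap _,
      ← integral_const_mul]
    refine integral_congr_ae (.of_forall fun x => ?_)
    have hsum := sum_fderivInnerNormalize_apply (EuclideanSpace.basisFun (Fin d) ℝ) (s - x)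
    simp only [EuclideanSpace.basisFun_apply, Fintype.card_fin] at hsum
    simp only [smul_apply, smul_eq_mul, ← Finset.mul_sum, hsum]
    ring
end

section
/- Let d ≥ 3, let ρ be a bounded probability density on ℝ^d, and let k be an integer with 1 ≤ k ≤ d−3. Define G_k(s) = ∫_{ℝ^d} ‖s−x‖₂^{−k} ρ(x) dx. Then for every s ∈ ℝ^d, the Laplacian of G_k at s exists and equals Δ G_k(s) = −k (d−k−2) ∫_{ℝ^d} ‖s−x‖₂^{−(k+2)} ρ(x) dx. -/
open MeasureTheory

section Riesz

open Metric Set Filter Topology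

/-- Taylor remainder bound for a kernel with a singularity at the origin. -/
theorem abs_sub_sub_le_of_singular {E : Type*} [NormedAddCommGroup E] [NormedSpace ℝ E]
    {A : ℝ} {q : ℕ} {K : E → ℝ} {K' : E → E →L[ℝ] ℝ} (hA : 0 ≤ A)
    (hK : ∀ x, |K x| ≤ A * (‖x‖ * (‖x‖ ^ q)⁻¹)) (hK' : ∀ x, ‖K' x‖ ≤ A * (‖x‖ ^ q)⁻¹)
    (hd : ∀ x, x ≠ 0 → HasFDerivAt K (K' x) x) (u h : E) :
    |K (u + h) - K u - K' u h| ≤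
      A * (2 ^ q + 4) * ‖h‖ * ((‖u‖ ^ q)⁻¹ + (‖u + h‖ ^ q)⁻¹) := by
  have hw : 0 ≤ (‖u‖ ^ q)⁻¹ := by positivity
  have hw2 : 0 ≤ (‖u + h‖ ^ q)⁻¹ := by positivity
  have h3 : |K' u h| ≤ A * (‖u‖ ^ q)⁻¹ * ‖h‖ :=
    ((K' u).le_opNorm h).trans (by gcongr; exact hK' u)
  have key : |K (u + h) - K u| ≤ A * (2 ^ q + 3) * ‖h‖ * ((‖u‖ ^ q)⁻¹ + (‖u + h‖ ^ q)⁻¹) := by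
    rcases eq_or_ne h 0 with rfl | hh
    · simp
    rcases le_or_gt ‖h‖ (‖u‖ / 2) with hu | hu
    · have hpos : 0 < ‖u‖ := by have := norm_pos_iff.2 hh; linarith
      have hz : ∀ z ∈ closedBall u (‖u‖ / 2), ‖u‖ / 2 ≤ ‖z‖ := by
        intro z hz
        have h1 : ‖z - u‖ ≤ ‖u‖ / 2 := by simpa [dist_eq_norm] using hz
        have h2 := norm_sub_norm_le u z
        rw [norm_sub_rev] at h2
        linarith
      have hmv := (convex_closedBall u (‖u‖ / 2)).norm_image_sub_le_of_norm_hasFDerivWithin_le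
        (f := K) (f' := K') (C := A * (2 ^ q * (‖u‖ ^ q)⁻¹)) (x := u) (y := u + h)
        (fun z hzz => (hd z (norm_pos_iff.1 (by linarith [hz z hzz]))).hasFDerivWithinAt)
        (fun z hzz => by
          refine (hK' z).trans ?_
          gcongr
          have := hz z hzz
          calc (‖z‖ ^ q)⁻¹ ≤ ((‖u‖ / 2) ^ q)⁻¹ := by gcongr
            _ = 2 ^ q * (‖u‖ ^ q)⁻¹ := by rw [div_pow, inv_div, div_eq_mul_inv])
        (mem_closedBall_self (by positivity)) (by simpa [dist_eq_norm] using hu)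
      rw [Real.norm_eq_abs, add_sub_cancel_left] at hmv
      refine hmv.trans ?_
      have e1 : 0 ≤ A * ‖h‖ * (‖u‖ ^ q)⁻¹ := by positivity
      have e2 : 0 ≤ A * (2 ^ q + 3) * ‖h‖ * (‖u + h‖ ^ q)⁻¹ := by positivity
      nlinarith
    · have h1 : |K (u + h)| ≤ A * (3 * ‖h‖ * (‖u + h‖ ^ q)⁻¹) := by
        refine (hK _).trans ?_
        gcongr
        linarith [norm_add_le u h]
      have h2 : |K u| ≤ A * (3 * ‖h‖ * (‖u‖ ^ q)⁻¹) := by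
        refine (hK _).trans ?_
        gcongr
        linarith [norm_nonneg h]
      refine (abs_sub _ _).trans ?_
      have e : 0 ≤ A * 2 ^ q * ‖h‖ * ((‖u‖ ^ q)⁻¹ + (‖u + h‖ ^ q)⁻¹) := by positivity
      nlinarith
  refine (abs_sub _ _).trans ?_
  have e : 0 ≤ A * ‖h‖ * (‖u + h‖ ^ q)⁻¹ := by positivity
  nlinarith

theorem inv_norm_pow_succ_mul {E : Type*} [NormedAddCommGroup E] (p : ℕ) {x : E} (hx : x ≠ 0) :
    ‖x‖ * (‖x‖ ^ (p + 1))⁻¹ = (‖x‖ ^ p)⁻¹ := by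
  have hx' : ‖x‖ ≠ 0 := norm_ne_zero_iff.2 hx
  field_simp
  ring

section Density

variable {E : Type*} [NormedAddCommGroup E] [NormedSpace ℝ E] [FiniteDimensional ℝ E]
  [MeasurableSpace E] [BorelSpace E] {μ : Measure E} [μ.IsAddHaarMeasure]
  {ρ : E → ℝ} {C A : ℝ} {q : ℕ} {K : E → ℝ} {K' : E → E →L[ℝ] ℝ}

theorem integrableOn_ball_inv_norm_pow (hq : q < Module.finrank ℝ E) (r : ℝ) :
    IntegrableOn (fun x : E => (‖x‖ ^ q)⁻¹) (ball 0 r) μ := by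
  refine integrableOn_ball_of_norm_le_rpow (by omega) (C := 1) (α := q) (by exact_mod_cast hq)
    (Eventually.of_forall fun x => ?_) ?_
  · rw [Real.rpow_neg (norm_nonneg x), Real.rpow_natCast, one_mul, Real.norm_of_nonneg (by positivity)]
  · exact ((measurable_norm.pow_const q).inv).aestronglyMeasurable

theorem integrableOn_ball_inv_norm_sub_pow (hq : q < Module.finrank ℝ E) (t : E) (r : ℝ) :
    IntegrableOn (fun x : E => (‖t - x‖ ^ q)⁻¹) (ball t r) μ := by
  have h := (Measure.measurePreserving_sub_left μ t).integrableOn_comp_preimage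
    (Homeomorph.subLeft t).measurableEmbedding
    (f := fun x : E => (‖x‖ ^ q)⁻¹) (s := ball 0 r)
  have hs : (fun x => t - x) ⁻¹' ball (0 : E) r = ball t r := by
    ext x; simp [mem_ball, dist_eq_norm, norm_sub_rev]
  rw [hs] at h
  exact h.2 (integrableOn_ball_inv_norm_pow hq r)

theorem setIntegral_ball_inv_norm_sub_pow (t : E) (r : ℝ) :
    ∫ x in ball t r, (‖t - x‖ ^ q)⁻¹ ∂μ = ∫ x in ball (0 : E) r, (‖x‖ ^ q)⁻¹ ∂μ := by
  have h := (Measure.measurePreserving_sub_left μ t).setIntegral_preimage_emb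
    (Homeomorph.subLeft t).measurableEmbedding
    (fun x : E => (‖x‖ ^ q)⁻¹) (ball 0 r)
  have hs : (fun x => t - x) ⁻¹' ball (0 : E) r = ball t r := by
    ext x; simp [mem_ball, dist_eq_norm, norm_sub_rev]
  rwa [hs] at h

theorem integrable_mul_inv_norm_sub_pow (hρ : Integrable ρ μ) (hρ0 : ∀ x, 0 ≤ ρ x)
    (hρC : ∀ᵐ x ∂μ, ρ x ≤ C) (hq : q < Module.finrank ℝ E) (t : E) :
    Integrable (fun x => ρ x * (‖t - x‖ ^ q)⁻¹) μ := by
  have hmeas : AEStronglyMeasurable (fun x => ρ x * (‖t - x‖ ^ q)⁻¹) μ :=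
    hρ.aestronglyMeasurable.mul (by fun_prop : Measurable _).aestronglyMeasurable
  rw [← integrableOn_univ, ← union_compl_self (ball t 1)]
  refine IntegrableOn.union ?_ ?_
  · refine Integrable.mono' ((integrableOn_ball_inv_norm_sub_pow hq t 1).const_mul C)
      hmeas.restrict ?_
    filter_upwards [ae_restrict_of_ae hρC] with x hx
    rw [Real.norm_of_nonneg (mul_nonneg (hρ0 x) (by positivity))]
    gcongr
  · refine Integrable.mono' hρ.integrableOn hmeas.restrict ?_
    filter_upwards [ae_restrict_mem measurableSet_ball.compl] with x hx
    rw [Real.norm_of_nonneg (mul_nonneg (hρ0 x) (by positivity))]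
    refine mul_le_of_le_one_right (hρ0 x) (inv_le_one_of_one_le₀ (one_le_pow₀ ?_))
    simpa [mem_ball, dist_eq_norm, norm_sub_rev] using hx

theorem setIntegral_mul_inv_norm_sub_pow_le (hρ : Integrable ρ μ) (hρ0 : ∀ x, 0 ≤ ρ x)
    (hρC : ∀ᵐ x ∂μ, ρ x ≤ C) (hq : q < Module.finrank ℝ E) (t : E) (r : ℝ) :
    ∫ x in ball t r, ρ x * (‖t - x‖ ^ q)⁻¹ ∂μ ≤ C * ∫ x in ball (0 : E) r, (‖x‖ ^ q)⁻¹ ∂μ := by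
  rw [← setIntegral_ball_inv_norm_sub_pow t r, ← integral_const_mul]
  refine integral_mono_ae (integrable_mul_inv_norm_sub_pow hρ hρ0 hρC hq t).integrableOn
    ((integrableOn_ball_inv_norm_sub_pow hq t r).const_mul C) ?_
  filter_upwards [ae_restrict_of_ae hρC] with x hx
  gcongr

theorem tendsto_setIntegral_ball_inv_norm_pow (hq : q < Module.finrank ℝ E) :
    Tendsto (fun n : ℕ => ∫ x in ball (0 : E) (1 / (n + 1)), (‖x‖ ^ q)⁻¹ ∂μ) atTop (𝓝 0) := by
  have : Nontrivial E := Module.nontrivial_of_finrank_pos (R := ℝ) (by omega)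
  have h := Antitone.tendsto_setIntegral (μ := μ) (f := fun x : E => (‖x‖ ^ q)⁻¹)
    (s := fun n : ℕ => ball (0 : E) (1 / (n + 1))) (fun _ => measurableSet_ball)
    (fun a b hab => ball_subset_ball (Nat.one_div_le_one_div hab))
    (integrableOn_ball_inv_norm_pow hq _)
  have hs : ⋂ n : ℕ, ball (0 : E) (1 / (n + 1)) = {0} := by
    ext x
    simp only [mem_iInter, mem_ball_zero_iff, mem_singleton_iff]
    refine ⟨fun hx => ?_, fun hx n => by rw [hx, norm_zero]; positivity⟩
    by_contra h0
    obtain ⟨n, hn⟩ := exists_nat_one_div_lt (norm_pos_iff.2 h0)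
    exact (hx n).not_gt hn
  rw [hs] at h
  simpa using h

theorem integrable_smul_kernel {F : Type*} [NormedAddCommGroup F] [NormedSpace ℝ F]
    {k : E → F} (hρ : Integrable ρ μ) (hρ0 : ∀ x, 0 ≤ ρ x)
    (hρC : ∀ᵐ x ∂μ, ρ x ≤ C) (hq : q < Module.finrank ℝ E)
    (hm : StronglyMeasurable k) (hk : ∀ x, ‖k x‖ ≤ A * (‖x‖ ^ q)⁻¹) (t : E) :
    Integrable (fun x => ρ x • k (t - x)) μ := by
  refine Integrable.mono' ((integrable_mul_inv_norm_sub_pow hρ hρ0 hρC hq t).const_mul A)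
    (hρ.aestronglyMeasurable.smul
      (hm.comp_measurable (measurable_const.sub measurable_id)).aestronglyMeasurable) ?_
  refine Eventually.of_forall fun x => ?_
  rw [norm_smul, Real.norm_of_nonneg (hρ0 x), mul_left_comm]
  exact mul_le_mul_of_nonneg_left (hk _) (hρ0 x)

theorem integrable_mul_kernel (hρ : Integrable ρ μ) (hρ0 : ∀ x, 0 ≤ ρ x)
    (hρC : ∀ᵐ x ∂μ, ρ x ≤ C) (hq1 : 1 ≤ q) (hq : q < Module.finrank ℝ E) (hA : 0 ≤ A)
    (hm : Measurable K) (hK : ∀ x, |K x| ≤ A * (‖x‖ * (‖x‖ ^ q)⁻¹)) (t : E) :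
    Integrable (fun x => ρ x * K (t - x)) μ := by
  refine integrable_smul_kernel (A := A) (q := q - 1) hρ hρ0 hρC (by omega)
    hm.stronglyMeasurable (fun x => (hK x).trans ?_) t
  obtain ⟨p, rfl⟩ := Nat.exists_eq_add_of_le' hq1
  gcongr
  rcases eq_or_ne ‖x‖ 0 with h | h
  · simp [h]
  · simp only [Nat.add_sub_cancel]
    rw [pow_succ, mul_inv, mul_left_comm, mul_inv_cancel₀ h, mul_one]

/-- Differentiation under the integral sign for the potential of a bounded density with respect
to a kernel whose gradient has an integrable singularity at the origin. -/
theorem hasFDerivAt_integral_singular_kernel (hρ : Integrable ρ μ) (hρ0 : ∀ x, 0 ≤ ρ x)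
    (hρC : ∀ᵐ x ∂μ, ρ x ≤ C) (hq1 : 1 ≤ q) (hq : q < Module.finrank ℝ E) (hA : 0 ≤ A)
    (hm : Measurable K) (hm' : StronglyMeasurable K')
    (hK : ∀ x, |K x| ≤ A * (‖x‖ * (‖x‖ ^ q)⁻¹)) (hK' : ∀ x, ‖K' x‖ ≤ A * (‖x‖ ^ q)⁻¹)
    (hd : ∀ x, x ≠ 0 → HasFDerivAt K (K' x) x) (t : E) :
    HasFDerivAt (fun t => ∫ x, ρ x * K (t - x) ∂μ) (∫ x, ρ x • K' (t - x) ∂μ) t := by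
  have hI : ∀ s, Integrable (fun x => ρ x * K (s - x)) μ :=
    integrable_mul_kernel hρ hρ0 hρC hq1 hq hA hm hK
  have hI' : ∀ s, Integrable (fun x => ρ x • K' (s - x)) μ :=
    integrable_smul_kernel hρ hρ0 hρC hq hm' hK'
  have hW : ∀ s, Integrable (fun x => ρ x * (‖s - x‖ ^ q)⁻¹) μ :=
    integrable_mul_inv_norm_sub_pow hρ hρ0 hρC hq
  have hfar : ∀ r > 0, HasFDerivAt (fun s => ∫ x in (ball t r)ᶜ, ρ x * K (s - x) ∂μ)
      (∫ x in (ball t r)ᶜ, ρ x • K' (t - x) ∂μ) t := by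
    intro r hr
    have hz : ∀ x ∈ (ball t r)ᶜ, ∀ s ∈ ball t (r / 2), r / 2 ≤ ‖s - x‖ := by
      intro x hx s hs
      have h1 : r ≤ dist x t := by simpa using hx
      have h2 : dist s t < r / 2 := hs
      have h3 := dist_triangle x s t
      rw [← dist_eq_norm, dist_comm]
      linarith
    refine hasFDerivAt_integral_of_dominated_of_fderiv_le (s := ball t (r / 2))
      (bound := fun x => ρ x * (A * ((r / 2) ^ q)⁻¹)) (F' := fun s x => ρ x • K' (s - x))
      (ball_mem_nhds t (by positivity))
      (Eventually.of_forall fun s => (hI s).aestronglyMeasurable.restrict)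
      (hI t).integrableOn (hI' t).aestronglyMeasurable.restrict ?_
      (hρ.integrableOn.mul_const _) ?_
    · filter_upwards [ae_restrict_mem measurableSet_ball.compl] with x hx s hs
      rw [norm_smul, Real.norm_of_nonneg (hρ0 x)]
      refine mul_le_mul_of_nonneg_left ((hK' _).trans ?_) (hρ0 x)
      have := hz x hx s hs
      gcongr
    · filter_upwards [ae_restrict_mem measurableSet_ball.compl] with x hx s hs
      have h0 : s - x ≠ 0 := norm_pos_iff.1 (by linarith [hz x hx s hs])
      simpa using! ((hd _ h0).comp s ((hasFDerivAt_id s).sub_const x)).const_mul (ρ x)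
  set B : ℝ := A * (2 ^ q + 4) with hB
  have hB0 : 0 ≤ B := by positivity
  refine .of_isLittleO (Asymptotics.isLittleO_iff.2 fun c hc => ?_)
  obtain ⟨n, hn⟩ : ∃ n : ℕ, 2 * B * C *
      ∫ x in ball (0 : E) (1 / (n + 1)), (‖x‖ ^ q)⁻¹ ∂μ < c / 2 := by
    have h := (tendsto_setIntegral_ball_inv_norm_pow (μ := μ) hq).const_mul (2 * B * C)
    rw [mul_zero] at h
    exact (h.eventually (gt_mem_nhds (by positivity : 0 < c / 2))).exists
  set r : ℝ := 1 / (n + 1) / 2 with hr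
  have hr0 : 0 < r := by positivity
  have hr2 : (1 / (n + 1) : ℝ) = 2 * r := by rw [hr]; ring
  rw [hr2] at hn
  have hf := Asymptotics.isLittleO_iff.1 (hfar r hr0).isLittleO (by positivity : 0 < c / 2)
  filter_upwards [hf, ball_mem_nhds t hr0] with s hs hsr
  have hnear : ‖∫ x in ball t r, (ρ x * K (s - x) - ρ x * K (t - x) -
      (ρ x • K' (t - x)) (s - t)) ∂μ‖ ≤ c / 2 * ‖s - t‖ := by
    have hb : ∀ x, ‖ρ x * K (s - x) - ρ x * K (t - x) - (ρ x • K' (t - x)) (s - t)‖ ≤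
        B * ‖s - t‖ * (ρ x * (‖t - x‖ ^ q)⁻¹ + ρ x * (‖s - x‖ ^ q)⁻¹) := by
      intro x
      have h := abs_sub_sub_le_of_singular hA hK hK' hd (t - x) (s - t)
      rw [show t - x + (s - t) = s - x by abel] at h
      have e : ρ x * K (s - x) - ρ x * K (t - x) - (ρ x • K' (t - x)) (s - t) =
          ρ x * (K (s - x) - K (t - x) - K' (t - x) (s - t)) := by
        simp only [smul_apply, smul_eq_mul]; ring
      rw [e, norm_mul, Real.norm_of_nonneg (hρ0 x), Real.norm_eq_abs]
      refine (mul_le_mul_of_nonneg_left h (hρ0 x)).trans_eq ?_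
      ring
    have hsub : ball t r ⊆ ball s (2 * r) := by
      intro x hx
      have h1 : dist x t < r := hx
      have h2 : dist s t < r := hsr
      rw [mem_ball]
      linarith [dist_triangle_right x s t]
    have hpos : ∀ s' x, 0 ≤ ρ x * (‖s' - x‖ ^ q)⁻¹ := fun s' x =>
      mul_nonneg (hρ0 x) (by positivity)
    have h1 : ∫ x in ball t r, ρ x * (‖t - x‖ ^ q)⁻¹ ∂μ ≤
        C * ∫ x in ball (0 : E) (2 * r), (‖x‖ ^ q)⁻¹ ∂μ :=
      (setIntegral_mono_set (hW t).integrableOn (Eventually.of_forall (hpos t))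
        (ball_subset_ball (by linarith)).eventuallyLE).trans
        (setIntegral_mul_inv_norm_sub_pow_le hρ hρ0 hρC hq t (2 * r))
    have h2 : ∫ x in ball t r, ρ x * (‖s - x‖ ^ q)⁻¹ ∂μ ≤
        C * ∫ x in ball (0 : E) (2 * r), (‖x‖ ^ q)⁻¹ ∂μ :=
      (setIntegral_mono_set (hW s).integrableOn (Eventually.of_forall (hpos s))
        hsub.eventuallyLE).trans
        (setIntegral_mul_inv_norm_sub_pow_le hρ hρ0 hρC hq s (2 * r))
    refine (norm_integral_le_of_norm_le
      (((hW t).add (hW s)).const_mul (B * ‖s - t‖)).integrableOn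
      (Eventually.of_forall hb)).trans ?_
    rw [integral_const_mul]
    have hadd := integral_add (hW t).integrableOn (hW s).integrableOn (μ := μ.restrict (ball t r))
    simp only [Pi.add_apply]
    rw [hadd]
    calc _ ≤ B * ‖s - t‖ * (C * (∫ x in ball (0 : E) (2 * r), (‖x‖ ^ q)⁻¹ ∂μ) +
            C * ∫ x in ball (0 : E) (2 * r), (‖x‖ ^ q)⁻¹ ∂μ) := by gcongr
      _ = 2 * B * C * (∫ x in ball (0 : E) (2 * r), (‖x‖ ^ q)⁻¹ ∂μ) * ‖s - t‖ := by ring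
      _ ≤ c / 2 * ‖s - t‖ := by gcongr
  have hsplit : (∫ x, ρ x * K (s - x) ∂μ) - (∫ x, ρ x * K (t - x) ∂μ) -
      (∫ x, ρ x • K' (t - x) ∂μ) (s - t) =
      (∫ x in ball t r, (ρ x * K (s - x) - ρ x * K (t - x) -
        (ρ x • K' (t - x)) (s - t)) ∂μ) +
      ((∫ x in (ball t r)ᶜ, ρ x * K (s - x) ∂μ) - (∫ x in (ball t r)ᶜ, ρ x * K (t - x) ∂μ) -
        (∫ x in (ball t r)ᶜ, ρ x • K' (t - x) ∂μ) (s - t)) := by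
    rw [integral_sub (f := fun x => ρ x * K (s - x) - ρ x * K (t - x))
        ((hI s).sub (hI t)).integrableOn ((hI' t).apply_continuousLinearMap (s - t)).integrableOn,
      integral_sub (hI s).integrableOn (hI t).integrableOn,
      ← ContinuousLinearMap.integral_apply (hI' t).integrableOn,
      ← integral_add_compl (measurableSet_ball (x := t) (ε := r)) (hI s),
      ← integral_add_compl (measurableSet_ball (x := t) (ε := r)) (hI t),
      ← integral_add_compl (measurableSet_ball (x := t) (ε := r)) (hI' t),
      add_apply]
    ring
  rw [hsplit]
  refine (norm_add_le _ _).trans ?_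
  linarith

end Density

section Kernel

variable {E : Type*} [NormedAddCommGroup E] [InnerProductSpace ℝ E]

theorem hasFDerivAt_inv_norm_pow (p : ℕ) {x : E} (hx : x ≠ 0) :
    HasFDerivAt (fun x : E => (‖x‖ ^ p)⁻¹) ((-(p : ℝ) * (‖x‖ ^ (p + 2))⁻¹) • innerSL ℝ x) x := by
  have hx' : ‖x‖ ≠ 0 := norm_ne_zero_iff.2 hx
  have h1 : HasFDerivAt (fun x : E => ‖x‖) (‖x‖⁻¹ • innerSL ℝ x) x := by
    have h := (hasStrictFDerivAt_norm_sq x).hasFDerivAt.sqrt (by positivity)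
    simp only [Real.sqrt_sq (norm_nonneg _)] at h
    convert h using 1
    ext v
    simp only [smul_apply, smul_eq_mul, nsmul_eq_mul]
    field_simp
    norm_num
  have h2 := (hasDerivAt_inv (pow_ne_zero p hx')).comp_hasFDerivAt x (h1.pow p)
  convert! h2 using 1
  ext v
  simp only [smul_apply, smul_eq_mul, nsmul_eq_mul]
  rcases p with _ | p
  · simp
  · simp only [Nat.add_sub_cancel]
    field_simp
    ring

theorem hasFDerivAt_inner_mul_inv_norm_pow (a : ℝ) (p : ℕ) (v : E) {x : E} (hx : x ≠ 0) :
    HasFDerivAt (fun x : E => a * (inner ℝ x v * (‖x‖ ^ p)⁻¹))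
      (a • ((‖x‖ ^ p)⁻¹ • innerSL ℝ v -
        (p * inner ℝ x v * (‖x‖ ^ (p + 2))⁻¹) • innerSL ℝ x)) x := by
  have h1 : HasFDerivAt (fun x : E => inner ℝ x v) (innerSL ℝ v) x := by
    simpa [real_inner_comm] using (innerSL ℝ v).hasFDerivAt (x := x)
  convert! (h1.mul (hasFDerivAt_inv_norm_pow p hx)).const_mul a using 1
  ext w
  simp only [smul_apply, smul_eq_mul, sub_apply,
    add_apply]
  ring

variable [FiniteDimensional ℝ E] [MeasurableSpace E] [BorelSpace E]
  {μ : Measure E} [μ.IsAddHaarMeasure] {ρ : E → ℝ} {C : ℝ} {k : ℕ}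

theorem hasFDerivAt_integral_div_norm_pow (hρ : Integrable ρ μ) (hρ0 : ∀ x, 0 ≤ ρ x)
    (hρC : ∀ᵐ x ∂μ, ρ x ≤ C) (hk1 : 1 ≤ k) (hk : k + 1 < Module.finrank ℝ E) (t : E) :
    HasFDerivAt (fun t => ∫ x, ρ x / ‖t - x‖ ^ k ∂μ)
      (∫ x, ρ x • ((-(k : ℝ) * (‖t - x‖ ^ (k + 2))⁻¹) • innerSL ℝ (t - x)) ∂μ) t ∧
    ∀ v, (∫ x, ρ x • ((-(k : ℝ) * (‖t - x‖ ^ (k + 2))⁻¹) • innerSL ℝ (t - x)) ∂μ) v =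
      ∫ x, ρ x * (-(k : ℝ) * (inner ℝ (t - x) v * (‖t - x‖ ^ (k + 2))⁻¹)) ∂μ := by
  have hk1' : (1 : ℝ) ≤ k := by exact_mod_cast hk1
  have hm' : StronglyMeasurable
      (fun x : E => (-(k : ℝ) * (‖x‖ ^ (k + 2))⁻¹) • innerSL ℝ x) :=
    ((by fun_prop : Measurable fun x : E => -(k : ℝ) * (‖x‖ ^ (k + 2))⁻¹)).stronglyMeasurable.smul
      (innerSL ℝ).continuous.stronglyMeasurable
  have hK' : ∀ x : E, ‖(-(k : ℝ) * (‖x‖ ^ (k + 2))⁻¹) • innerSL ℝ x‖ ≤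
      k * (‖x‖ ^ (k + 1))⁻¹ := by
    intro x
    rcases eq_or_ne x 0 with rfl | hx
    · simp
    rw [norm_smul, innerSL_apply_norm, norm_mul, norm_neg, Real.norm_natCast,
      Real.norm_of_nonneg (by positivity), mul_assoc, mul_comm _ ‖x‖, inv_norm_pow_succ_mul _ hx]
  refine ⟨?_, fun v => ?_⟩
  · simp only [div_eq_mul_inv]
    refine hasFDerivAt_integral_singular_kernel (A := k) (q := k + 1) hρ hρ0 hρC (by omega) hk
      (by positivity) (K := fun x => (‖x‖ ^ k)⁻¹)
      (K' := fun x => (-(k : ℝ) * (‖x‖ ^ (k + 2))⁻¹) • innerSL ℝ x)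
      (by fun_prop) hm' (fun x => ?_) hK' (fun x hx => hasFDerivAt_inv_norm_pow k hx) t
    rcases eq_or_ne x 0 with rfl | hx
    · simp [show k ≠ 0 by omega]
    rw [inv_norm_pow_succ_mul _ hx, abs_of_nonneg (by positivity)]
    exact le_mul_of_one_le_left (by positivity) hk1'
  · rw [ContinuousLinearMap.integral_apply
      (integrable_smul_kernel hρ hρ0 hρC hk hm' hK' t)]
    refine integral_congr_ae (Eventually.of_forall fun x => ?_)
    simp only [smul_apply, smul_eq_mul, innerSL_apply_apply]
    ring

theorem hasFDerivAt_integral_inner_mul_inv_norm_pow (hρ : Integrable ρ μ) (hρ0 : ∀ x, 0 ≤ ρ x)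
    (hρC : ∀ᵐ x ∂μ, ρ x ≤ C) (a : ℝ) (hk : k + 2 < Module.finrank ℝ E) (v t : E) :
    let K' : E → E →L[ℝ] ℝ := fun x => a • ((‖x‖ ^ (k + 2))⁻¹ • innerSL ℝ v -
        (((k + 2 : ℕ) : ℝ) * inner ℝ x v * (‖x‖ ^ (k + 2 + 2))⁻¹) • innerSL ℝ x)
    HasFDerivAt (fun t => ∫ x, ρ x * (a * (inner ℝ (t - x) v * (‖t - x‖ ^ (k + 2))⁻¹)) ∂μ)
      (∫ x, ρ x • K' (t - x) ∂μ) t ∧ Integrable (fun x => ρ x • K' (t - x)) μ := by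
  intro K'
  have hm' : StronglyMeasurable K' := by
    refine StronglyMeasurable.const_smul (StronglyMeasurable.sub ?_ ?_) a
    · exact (by fun_prop : Measurable fun x : E => (‖x‖ ^ (k + 2))⁻¹).stronglyMeasurable.smul
        stronglyMeasurable_const
    · exact (by fun_prop : Measurable fun x : E =>
        ((k + 2 : ℕ) : ℝ) * inner ℝ x v * (‖x‖ ^ (k + 2 + 2))⁻¹).stronglyMeasurable.smul
        (innerSL ℝ).continuous.stronglyMeasurable
  have hK' : ∀ x : E, ‖K' x‖ ≤ (|a| * ((k + 3) * ‖v‖)) * (‖x‖ ^ (k + 2))⁻¹ := by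
    intro x
    rcases eq_or_ne x 0 with rfl | hx
    · simp [K', norm_zero]
    have hx' : ‖x‖ ≠ 0 := norm_ne_zero_iff.2 hx
    simp only [K']
    rw [norm_smul, Real.norm_eq_abs, mul_assoc |a|]
    gcongr
    refine (norm_sub_le ((‖x‖ ^ (k + 2))⁻¹ • innerSL ℝ v) _).trans ?_
    rw [norm_smul, norm_smul, innerSL_apply_norm, innerSL_apply_norm, norm_mul, norm_mul,
      Real.norm_natCast, Real.norm_of_nonneg (by positivity : 0 ≤ (‖x‖ ^ (k + 2))⁻¹),
      Real.norm_of_nonneg (by positivity : 0 ≤ (‖x‖ ^ (k + 2 + 2))⁻¹)]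
    calc _ ≤ (‖x‖ ^ (k + 2))⁻¹ * ‖v‖ +
          ((k + 2 : ℕ) : ℝ) * (‖x‖ * ‖v‖) * (‖x‖ ^ (k + 2 + 2))⁻¹ * ‖x‖ := by
            gcongr; exact norm_inner_le_norm (𝕜 := ℝ) x v
      _ = _ := by
        push_cast
        field_simp
        ring
  refine ⟨?_, integrable_smul_kernel hρ hρ0 hρC hk hm' hK' t⟩
  refine hasFDerivAt_integral_singular_kernel hρ hρ0 hρC (by omega) hk (by positivity)
    (K := fun x => a * (inner ℝ x v * (‖x‖ ^ (k + 2))⁻¹))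
    (by fun_prop) hm' (fun x => ?_) hK'
    (fun x hx => hasFDerivAt_inner_mul_inv_norm_pow a (k + 2) v hx) t
  rw [abs_mul, abs_mul, abs_of_nonneg (by positivity : 0 ≤ (‖x‖ ^ (k + 2))⁻¹)]
  calc _ ≤ |a| * ((‖x‖ * ‖v‖) * (‖x‖ ^ (k + 2))⁻¹) := by
        gcongr; exact abs_real_inner_le_norm x v
    _ = |a| * (1 * ‖v‖) * (‖x‖ * (‖x‖ ^ (k + 2))⁻¹) := by ring
    _ ≤ _ := by
        gcongr
        have : (0 : ℝ) ≤ k := by positivity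
        linarith

end Kernel

end Riesz

/-- For `d ≥ 3`, a bounded probability density `ρ` on `ℝ^d` and `1 ≤ k ≤ d - 3`, the
Laplacian of `G_k(s) = ∫ ‖s-x‖₂⁻ᵏ ρ(x) dx` exists at every `s` and equals
`-k (d - k - 2) ∫ ‖s-x‖₂^{-(k+2)} ρ(x) dx`. -/
theorem laplacian_integral_inv_norm_pow
    (d : ℕ) (hd : 3 ≤ d)
    (ρ : EuclideanSpace ℝ (Fin d) → ℝ)
    (hρ_meas : Measurable ρ)
    (hρ_nonneg : ∀ x, 0 ≤ ρ x)
    (C : ℝ) (hρ_bdd : ∀ᵐ x ∂volume, ρ x ≤ C)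
    (hρ_int : ∫ x, ρ x ∂volume = 1)
    (k : ℕ) (hk1 : 1 ≤ k) (hk2 : k ≤ d - 3)
    (s : EuclideanSpace ℝ (Fin d)) :
    HasLaplacianAt (fun t => ∫ x, ρ x / ‖t - x‖ ^ k ∂volume)
      (-(k : ℝ) * ((d : ℝ) - (k : ℝ) - 2) * ∫ x, ρ x / ‖s - x‖ ^ (k + 2) ∂volume) s := by
  have hρ : Integrable ρ volume := Integrable.of_integral_ne_zero (by simp [hρ_int])
  have hdim : Module.finrank ℝ (EuclideanSpace ℝ (Fin d)) = d := by simp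
  have h1 := hasFDerivAt_integral_div_norm_pow hρ hρ_nonneg hρ_bdd hk1 (by omega)
  have h2 := fun i : Fin d => hasFDerivAt_integral_inner_mul_inv_norm_pow (k := k) hρ hρ_nonneg
    hρ_bdd (-(k : ℝ)) (by omega) (EuclideanSpace.single i (1 : ℝ)) s
  have h3 : ∀ v, (fun y => fderiv ℝ (fun t => ∫ x, ρ x / ‖t - x‖ ^ k ∂volume) y v) =
      fun y => ∫ x, ρ x * (-(k : ℝ) * (inner ℝ (y - x) v * (‖y - x‖ ^ (k + 2))⁻¹)) := by
    intro v
    funext y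
    rw [(h1 y).1.fderiv, (h1 y).2]
  refine ⟨(h1 s).1.differentiableAt, fun i => ?_, ?_⟩
  · rw [h3]
    exact (h2 i).1.differentiableAt
  · have h4 : ∀ i : Fin d,
        fderiv ℝ (fun y => fderiv ℝ (fun t => ∫ x, ρ x / ‖t - x‖ ^ k ∂volume) y
          (EuclideanSpace.single i (1 : ℝ))) s (EuclideanSpace.single i (1 : ℝ)) =
        ∫ x, ρ x * (-(k : ℝ) * ((‖s - x‖ ^ (k + 2))⁻¹ -
          (k + 2) * (s - x) i ^ 2 * (‖s - x‖ ^ (k + 2 + 2))⁻¹)) := by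
      intro i
      rw [h3, (h2 i).1.fderiv, ContinuousLinearMap.integral_apply (h2 i).2]
      refine integral_congr_ae (Filter.Eventually.of_forall fun x => ?_)
      simp [EuclideanSpace.inner_single_right]
      ring_nf
      simp
    have h5 : ∀ i : Fin d, Integrable (fun x => ρ x * (-(k : ℝ) * ((‖s - x‖ ^ (k + 2))⁻¹ -
          (k + 2) * (s - x) i ^ 2 * (‖s - x‖ ^ (k + 2 + 2))⁻¹))) volume := by
      intro i
      refine ((h2 i).2.apply_continuousLinearMap (EuclideanSpace.single i (1 : ℝ))).congr
        (Filter.Eventually.of_forall fun x => ?_)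
      simp [EuclideanSpace.inner_single_right]
      ring_nf
      simp
    rw [Finset.sum_congr rfl fun i _ => h4 i, ← integral_finsetSum _ fun i _ => h5 i,
      ← integral_const_mul]
    refine integral_congr_ae (Filter.Eventually.of_forall fun x => ?_)
    have hn : ∑ i, (s - x) i ^ 2 = ‖s - x‖ ^ 2 := by
      rw [EuclideanSpace.norm_sq_eq]; simp
    simp only
    rw [← Finset.mul_sum, ← Finset.mul_sum, Finset.sum_sub_distrib, ← Finset.sum_mul,
      ← Finset.mul_sum, hn]
    simp only [Finset.sum_const, Finset.card_univ, Fintype.card_fin, nsmul_eq_mul]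
    rcases eq_or_ne ‖s - x‖ 0 with h0 | h0
    · simp [h0]
    · field_simp
      ring
end
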